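/- arXiv:1003.3320 — 3 statements merged into one kernel-verified Lean document; each statement's English description precedes it below -/
import Mathlib

section
/- Let p and q be natural numbers with q ≠ p+1 and set m = p−q. A real number δ is critical, i.e. there exist natural numbers k > l ≥ 0 with α(k,δ) = α(l,δ), if and only if δ belongs to the union over k ≥ 1 of the finite sets { (2k−l+m)/(m+1) : l = 1, …, k }. -/
/-- The Casimir eigenvalue `α(k,δ)` on weighted symmetric tensor fields of degree `k`
and weight `δ`, where `m = p - q` is the superdimension. -/
noncomputable def casimirEigenvalue (m : ℤ) (δ : ℝ) (k : ℕ) : ℝ :=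
  ((m : ℝ) / 2) * δ ^ 2 - ((2 * (k : ℝ) + (m : ℝ)) / 2) * δ +
    ((k : ℝ) * ((k : ℝ) + (m : ℝ))) / ((m : ℝ) + 1)

theorem casimirEigenvalue_eq_iff (m : ℤ) (δ : ℝ) {k l : ℕ} (hkl : k ≠ l) :
    casimirEigenvalue m δ k = casimirEigenvalue m δ l ↔
      δ = ((k : ℝ) + l + m) / ((m : ℝ) + 1) := by
  have hsub : (k : ℝ) - l ≠ 0 := sub_ne_zero.mpr (Nat.cast_injective.ne hkl)
  have hdiff : casimirEigenvalue m δ k - casimirEigenvalue m δ l =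
      ((k : ℝ) - l) * (((k : ℝ) + l + m) / ((m : ℝ) + 1) - δ) := by
    unfold casimirEigenvalue
    ring
  rw [← sub_eq_zero, hdiff, mul_eq_zero_iff_left hsub, sub_eq_zero, eq_comm]

/-- A value `δ` is critical for the `sl(p+1|q)`-equivariant quantization over `ℝ^{p|q}`
(with `q ≠ p+1`) if and only if it belongs to
`⋃_{k ≥ 1} { (2k - l + (p-q)) / (p-q+1) : l = 1, …, k }`. -/
theorem critical_values (p q : ℕ) (hq : q ≠ p + 1) (δ : ℝ) :
    (∃ k l : ℕ, l < k ∧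
      casimirEigenvalue ((p : ℤ) - (q : ℤ)) δ k = casimirEigenvalue ((p : ℤ) - (q : ℤ)) δ l) ↔
    (∃ k l : ℕ, 1 ≤ k ∧ 1 ≤ l ∧ l ≤ k ∧
      δ = (2 * (k : ℝ) - (l : ℝ) + ((p : ℝ) - (q : ℝ))) / (((p : ℝ) - (q : ℝ)) + 1)) := by
  have hcast : (((p : ℤ) - (q : ℤ) : ℤ) : ℝ) = (p : ℝ) - q := by push_cast; ring
  constructor
  · rintro ⟨k, l, hlk, h⟩
    refine ⟨k, k - l, by omega, by omega, Nat.sub_le k l, ?_⟩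
    rw [casimirEigenvalue_eq_iff _ δ hlk.ne'] at h
    rw [h, hcast, Nat.cast_sub hlk.le]
    ring
  · rintro ⟨k, l, -, hl, hlk, h⟩
    refine ⟨k, k - l, by omega, ?_⟩
    rw [casimirEigenvalue_eq_iff _ δ (by omega), h, hcast, Nat.cast_sub hlk]
    ring
end

section
/- Let p and q be natural numbers with p ≠ q, set m = p − q, and consider diagonal real (p+q)×(p+q) matrices with entries indexed by {1,…,p+q}, where ε(i) = 0 if i ≤ p and ε(i) = 1 otherwise, and str(D) = ∑_i (−1)^{ε(i)} D_{ii}. For each i ∈ {1,…,p+q} there exists a unique diagonal matrix D^{(i)} with str(D^{(i)}) = 0 such that 2m·str(D^{(i)}·H) = H_{ii} for every diagonal matrix H with str(H) = 0; moreover its entries are D^{(i)}_{jj} = (−1)^{ε(i)}·δ_{ij}/(2m) − 1/(2m²). -/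
/-- Parity of the (0-based) index `i` of `ℝ^{p|q}`: `0` for the first `p` indices,
`1` for the remaining ones. -/
def finParity (p : ℕ) {n : ℕ} (i : Fin n) : ℕ := if (i : ℕ) < p then 0 else 1

/-- Supertrace of a diagonal matrix of `gl(p|q)`, given by its diagonal entries. -/
noncomputable def diagStr (p q : ℕ) (D : Fin (p + q) → ℝ) : ℝ :=
  ∑ j, (-1 : ℝ) ^ (finParity p j) * D j

/-- The superidentity has supertrace `p - q`. -/
theorem sum_neg_one_pow_finParity (p q : ℕ) :
    ∑ j : Fin (p + q), (-1 : ℝ) ^ finParity p j = (p : ℝ) - q := by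
  simp [Fin.sum_univ_add, finParity, sub_eq_add_neg]

theorem neg_one_pow_finParity_mul_self (p : ℕ) {n : ℕ} (i : Fin n) :
    (-1 : ℝ) ^ finParity p i * (-1 : ℝ) ^ finParity p i = 1 := by
  rw [← mul_pow]
  simp

/-- The entries of the diagonal matrix dual to the `i`-th diagonal entry. -/
noncomputable def dualDiag (p q : ℕ) (i j : Fin (p + q)) : ℝ :=
  (-1 : ℝ) ^ (finParity p i) * (if i = j then 1 else 0) / (2 * ((p : ℝ) - (q : ℝ))) -
    1 / (2 * ((p : ℝ) - (q : ℝ)) ^ 2)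

theorem dualDiag_comm (p q : ℕ) (i j : Fin (p + q)) : dualDiag p q i j = dualDiag p q j i := by
  by_cases h : i = j
  · rw [h]
  · simp [dualDiag, h, Ne.symm h]

/-- Supertrace of the product of `dualDiag p q i` with an arbitrary diagonal matrix. -/
theorem sum_dualDiag_mul (p q : ℕ) (i : Fin (p + q)) (H : Fin (p + q) → ℝ) :
    ∑ j, (-1 : ℝ) ^ (finParity p j) * dualDiag p q i j * H j =
      H i / (2 * ((p : ℝ) - q)) - diagStr p q H / (2 * ((p : ℝ) - q) ^ 2) := by
  have hterm (j : Fin (p + q)) : (-1 : ℝ) ^ (finParity p j) * dualDiag p q i j * H j =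
      (if i = j then H j / (2 * ((p : ℝ) - q)) else 0) -
        (-1 : ℝ) ^ (finParity p j) * H j / (2 * ((p : ℝ) - q) ^ 2) := by
    by_cases h : i = j
    · subst h
      simp only [dualDiag, if_true]
      linear_combination
        H i / (2 * ((p : ℝ) - q)) * neg_one_pow_finParity_mul_self p i
    · simp only [dualDiag, if_neg h]
      ring
  simp only [hterm, Finset.sum_sub_distrib, Finset.sum_ite_eq, Finset.mem_univ, if_true,
    diagStr, Finset.sum_div]

theorem diagStr_dualDiag {p q : ℕ} (hpq : p ≠ q) (i : Fin (p + q)) :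
    diagStr p q (dualDiag p q i) = 0 := by
  have hm : (p : ℝ) - q ≠ 0 := sub_ne_zero.mpr (Nat.cast_injective.ne hpq)
  have h := sum_dualDiag_mul p q i fun _ => 1
  simp only [diagStr, mul_one, sum_neg_one_pow_finParity] at h ⊢
  rw [h]
  field_simp
  ring

theorem two_mul_sum_dualDiag_mul {p q : ℕ} (hpq : p ≠ q) (i : Fin (p + q))
    {H : Fin (p + q) → ℝ} (hH : diagStr p q H = 0) :
    2 * ((p : ℝ) - q) * (∑ j, (-1 : ℝ) ^ (finParity p j) * dualDiag p q i j * H j) = H i := by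
  have hm : (p : ℝ) - q ≠ 0 := sub_ne_zero.mpr (Nat.cast_injective.ne hpq)
  rw [sum_dualDiag_mul, hH]
  field_simp
  ring

/-- For `p ≠ q` and each index `i`, there is a unique supertraceless diagonal matrix
`D^{(i)}` with `2(p-q)·str(D^{(i)}·H) = H_{ii}` for every supertraceless diagonal `H`;
moreover its entries are `D^{(i)}_{jj} = (-1)^{ε(i)} δ_{ij}/(2(p-q)) - 1/(2(p-q)²)`. -/
theorem dual_diagonal_matrix (p q : ℕ) (hpq : p ≠ q) (i : Fin (p + q)) :
    (∃! D : Fin (p + q) → ℝ, diagStr p q D = 0 ∧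
      ∀ H : Fin (p + q) → ℝ, diagStr p q H = 0 →
        2 * ((p : ℝ) - (q : ℝ)) *
            (∑ j, (-1 : ℝ) ^ (finParity p j) * D j * H j) = H i) ∧
    (diagStr p q (fun j =>
        (-1 : ℝ) ^ (finParity p i) * (if i = j then 1 else 0) /
            (2 * ((p : ℝ) - (q : ℝ))) -
          1 / (2 * ((p : ℝ) - (q : ℝ)) ^ 2)) = 0 ∧
      ∀ H : Fin (p + q) → ℝ, diagStr p q H = 0 →
        2 * ((p : ℝ) - (q : ℝ)) *
            (∑ j, (-1 : ℝ) ^ (finParity p j) *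
              ((-1 : ℝ) ^ (finParity p i) * (if i = j then 1 else 0) /
                  (2 * ((p : ℝ) - (q : ℝ))) -
                1 / (2 * ((p : ℝ) - (q : ℝ)) ^ 2)) * H j) = H i) := by
  have hdual : ∀ H : Fin (p + q) → ℝ, diagStr p q H = 0 → 2 * ((p : ℝ) - q) *
      (∑ j, (-1 : ℝ) ^ (finParity p j) * dualDiag p q i j * H j) = H i :=
    fun H hH => two_mul_sum_dualDiag_mul hpq i hH
  refine ⟨⟨dualDiag p q i, ⟨diagStr_dualDiag hpq i, hdual⟩, ?_⟩, diagStr_dualDiag hpq i, hdual⟩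
  rintro D ⟨hD, hDdual⟩
  funext j
  rw [dualDiag_comm, ← hDdual _ (diagStr_dualDiag hpq j), ← two_mul_sum_dualDiag_mul hpq j hD]
  simp only [mul_right_comm]
end

section
/- Let p ≥ 1 be a natural number, k a natural number and δ a real number. Consider diagonal real 2p×2p matrices indexed by {1,…,2p}, with ε(i) = 0 for i ≤ p and ε(i) = 1 for i > p, str(H) = ∑_i (−1)^{ε(i)} H_{ii}, and K₀(Δ,H) = 2·(str(Δ·H) − str(Δ)·str(H)). Define the linear functional Λ(H) = k·H_{11} − δ·str(H) and the linear functional (2ρ_S)(H) = ∑_{r=1}^{p} (1−2r)·H_{rr} + ∑_{r=1}^{p} (2p+1−2r)·H_{p+r,p+r}. Then there is a unique diagonal matrix Δ with K₀(Δ,H) = Λ(H) for every diagonal H, given by Δ_{ii} = (k−δ)/2 + (k/2)·δ_{i1}; and moreover Λ(Δ) = k(k−δ) and (2ρ_S)(Δ) = −k/2. -/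
/-- Parity of the (0-based) index `i` of `ℝ^{p|p}`: `0` for the first `p` indices,
`1` for the last `p`. -/
def parityPP (p : ℕ) (i : Fin (2 * p)) : ℕ := if (i : ℕ) < p then 0 else 1

/-- Supertrace of a diagonal matrix of `gl(p|p)`, given by its diagonal entries. -/
noncomputable def strDiagPP (p : ℕ) (H : Fin (2 * p) → ℝ) : ℝ :=
  ∑ i, (-1 : ℝ) ^ (parityPP p i) * H i

/-- The invariant form `K₀(Δ,H) = 2(str(ΔH) - str(Δ)str(H))` induced on diagonal
matrices of `gl(p|p)` by the Killing form of `sl(p+1|p)`. -/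
noncomputable def K0form (p : ℕ) (D H : Fin (2 * p) → ℝ) : ℝ :=
  2 * ((∑ i, (-1 : ℝ) ^ (parityPP p i) * D i * H i) - strDiagPP p D * strDiagPP p H)

/-- The highest weight `Λ = kη₁ - δ·str` of the `gl(p|p)`-module `S^k_δ`, as a linear
functional on diagonal matrices (`H_{11}` is the first diagonal entry). -/
noncomputable def LambdaWeight (p : ℕ) (hp : 1 ≤ p) (k : ℕ) (δ : ℝ)
    (H : Fin (2 * p) → ℝ) : ℝ :=
  (k : ℝ) * H ⟨0, by omega⟩ - δ * strDiagPP p H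

/-- The functional `2ρ_S` on diagonal matrices of `gl(p|p)`:
`(2ρ_S)(H) = ∑_{r=1}^p (1-2r) H_{rr} + ∑_{r=1}^p (2p+1-2r) H_{p+r,p+r}`. -/
noncomputable def twoRhoS (p : ℕ) (H : Fin (2 * p) → ℝ) : ℝ :=
  ∑ i : Fin (2 * p), (if (i : ℕ) < p then 1 - 2 * ((i : ℕ) + 1 : ℝ)
    else 2 * (p : ℝ) + 1 - 2 * (((i : ℕ) : ℝ) - (p : ℝ) + 1)) * H i

/-- A sum over `Fin (2 * p)` splits into its even and odd halves. -/
theorem sum_fin_two_mul (p : ℕ) (f : ℕ → ℝ) :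
    ∑ i : Fin (2 * p), f i = ∑ i ∈ Finset.range p, f i + ∑ i ∈ Finset.range p, f (p + i) := by
  rw [Fin.sum_univ_eq_sum_range, two_mul, Finset.sum_range_add]

/-- The supertrace of the identity of `gl(p|p)` vanishes. -/
theorem sum_neg_one_pow_parityPP (p : ℕ) :
    ∑ i : Fin (2 * p), (-1 : ℝ) ^ (parityPP p i) = 0 := by
  have h := sum_fin_two_mul p fun i => (-1 : ℝ) ^ (if i < p then 0 else 1)
  have h₁ : ∑ i ∈ Finset.range p, (-1 : ℝ) ^ (if i < p then 0 else 1) = p := by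
    rw [Finset.sum_congr rfl (g := fun _ => (1 : ℝ))]
    · simp
    · intro i hi
      simp [Finset.mem_range.1 hi]
  rw [h₁] at h
  simpa [parityPP] using h

theorem strDiagPP_const (p : ℕ) (c : ℝ) : strDiagPP p (fun _ => c) = 0 := by
  rw [strDiagPP, ← Finset.sum_mul, sum_neg_one_pow_parityPP, zero_mul]

/-- The coefficients of `2ρ_S` sum to zero. -/
theorem twoRhoS_one (p : ℕ) : twoRhoS p (fun _ => 1) = 0 := by
  have h := sum_fin_two_mul p fun i => if i < p then 1 - 2 * ((i : ℕ) + 1 : ℝ)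
    else 2 * (p : ℝ) + 1 - 2 * ((i : ℝ) - (p : ℝ) + 1)
  simp only [twoRhoS, mul_one]
  rw [h, ← Finset.sum_add_distrib]
  have h₁ : ∀ i ∈ Finset.range p, ((if i < p then 1 - 2 * ((i : ℕ) + 1 : ℝ)
      else 2 * (p : ℝ) + 1 - 2 * ((i : ℝ) - (p : ℝ) + 1)) +
      (if p + i < p then 1 - 2 * (((p + i : ℕ) : ℝ) + 1)
      else 2 * (p : ℝ) + 1 - 2 * (((p + i : ℕ) : ℝ) - (p : ℝ) + 1))) =
      2 * (p : ℝ) - 2 - 4 * (i : ℝ) := by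
    intro i hi
    rw [if_pos (Finset.mem_range.1 hi), if_neg (by omega)]
    push_cast
    ring
  rw [Finset.sum_congr rfl h₁]
  have h₂ : ∀ n : ℕ, ∑ i ∈ Finset.range n, (2 * (p : ℝ) - 2 - 4 * (i : ℝ)) =
      2 * n * ((p : ℝ) - n) := by
    intro n
    induction n with
    | zero => simp
    | succ n ih =>
      rw [Finset.sum_range_succ, ih]
      push_cast
      ring
  rw [h₂, sub_self, mul_zero]

/-- Pairing weights `w` with `a + b·e₁`. -/
theorem sum_mul_const_add_first {n : ℕ} (hn : 0 < n) (w : Fin n → ℝ) (a b : ℝ) :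
    ∑ i, w i * (a + (if (i : ℕ) = 0 then b else 0)) = a * ∑ i, w i + b * w ⟨0, hn⟩ := by
  have h : ∀ i : Fin n, w i * (a + (if (i : ℕ) = 0 then b else 0)) =
      a * w i + (if i = ⟨0, hn⟩ then b * w i else 0) := by
    intro i
    simp only [Fin.ext_iff]
    split_ifs <;> ring
  simp only [h, Finset.sum_add_distrib, ← Finset.mul_sum, Finset.sum_ite_eq', Finset.mem_univ,
    if_true]

theorem strDiagPP_const_add_first (p : ℕ) (hp : 1 ≤ p) (a b : ℝ) :
    strDiagPP p (fun i => a + (if (i : ℕ) = 0 then b else 0)) = b := by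
  rw [strDiagPP, sum_mul_const_add_first (by omega), sum_neg_one_pow_parityPP]
  simp [parityPP, show 0 < p by omega]

theorem K0form_const_add_first (p : ℕ) (hp : 1 ≤ p) (a b : ℝ) (H : Fin (2 * p) → ℝ) :
    K0form p (fun i => a + (if (i : ℕ) = 0 then b else 0)) H =
      2 * (a * strDiagPP p H + b * H ⟨0, by omega⟩ - b * strDiagPP p H) := by
  rw [K0form, strDiagPP_const_add_first p hp]
  simp only [mul_right_comm _ _ (H _)]
  rw [sum_mul_const_add_first (by omega) fun i => (-1 : ℝ) ^ (parityPP p i) * H i]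
  simp [strDiagPP, parityPP, show 0 < p by omega]

theorem K0form_single (p : ℕ) (D : Fin (2 * p) → ℝ) (j : Fin (2 * p)) :
    K0form p D (Pi.single j 1) = 2 * (-1 : ℝ) ^ (parityPP p j) * (D j - strDiagPP p D) := by
  have h : strDiagPP p (Pi.single j 1) = (-1 : ℝ) ^ (parityPP p j) := by
    simp [strDiagPP, Pi.single_apply]
  rw [K0form, h]
  simp only [Pi.single_apply, mul_ite, mul_one, mul_zero, Finset.sum_ite_eq', Finset.mem_univ,
    if_true]
  ring

/-- The form `K₀` is nondegenerate on diagonal matrices. -/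
theorem K0form_left_injective (p : ℕ) : Function.Injective (K0form p) := by
  intro D E h
  have hsub : ∀ j, D j - E j = strDiagPP p D - strDiagPP p E := by
    intro j
    have hj := congrFun h (Pi.single j 1)
    rw [K0form_single, K0form_single] at hj
    have := mul_left_cancel₀ (by simp) hj
    linarith
  have hstr : strDiagPP p D - strDiagPP p E = 0 := by
    rw [← strDiagPP_const p (strDiagPP p D - strDiagPP p E)]
    conv_lhs => rw [strDiagPP, strDiagPP, ← Finset.sum_sub_distrib]
    conv_rhs => rw [strDiagPP]
    refine Finset.sum_congr rfl fun i _ => ?_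
    rw [← mul_sub, hsub]
  funext j
  linarith [hsub j]

/-- There is a unique diagonal `Δ` with `K₀(Δ,·) = Λ`, given by
`Δ_{ii} = (k-δ)/2 + (k/2)δ_{i1}`; moreover `(Λ,Λ) = Λ(Δ) = k(k-δ)` and
`(Λ,2ρ_S) = (2ρ_S)(Δ) = -k/2`. -/
theorem highest_weight_casimir_data (p : ℕ) (hp : 1 ≤ p) (k : ℕ) (δ : ℝ) :
    (∃! D : Fin (2 * p) → ℝ, ∀ H, K0form p D H = LambdaWeight p hp k δ H) ∧
    (∀ H, K0form p
        (fun i => ((k : ℝ) - δ) / 2 + (if (i : ℕ) = 0 then (k : ℝ) / 2 else 0)) H =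
      LambdaWeight p hp k δ H) ∧
    LambdaWeight p hp k δ
        (fun i => ((k : ℝ) - δ) / 2 + (if (i : ℕ) = 0 then (k : ℝ) / 2 else 0)) =
      (k : ℝ) * ((k : ℝ) - δ) ∧
    twoRhoS p
        (fun i => ((k : ℝ) - δ) / 2 + (if (i : ℕ) = 0 then (k : ℝ) / 2 else 0)) =
      -(k : ℝ) / 2 := by
  have hK : ∀ H, K0form p
      (fun i => ((k : ℝ) - δ) / 2 + (if (i : ℕ) = 0 then (k : ℝ) / 2 else 0)) H =
      LambdaWeight p hp k δ H := by
    intro H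
    rw [K0form_const_add_first p hp, LambdaWeight]
    ring
  refine ⟨⟨_, hK, fun D hD => K0form_left_injective p (funext fun H => ?_)⟩, hK, ?_, ?_⟩
  · rw [hD, hK]
  · rw [LambdaWeight, strDiagPP_const_add_first p hp, if_pos rfl]
    ring
  · have h := twoRhoS_one p
    simp only [twoRhoS, mul_one] at h
    rw [twoRhoS, sum_mul_const_add_first (by omega), h, if_pos (show 0 < p by omega)]
    push_cast
    ring
end
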